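/- Let (X, d) be a metric space, μ a Borel probability measure, and T : X → X a measure-preserving map having superpolynomial decay of correlations with respect to Lipschitz observables. Let f : X → [0,∞) be ℓ-Lipschitz, set S_r = {x : f(x) ≤ r}, and suppose the limit d(f) = lim_{r→0} log μ(S_r) / log r exists. Then for μ-almost every x ∈ X, lim_{r→0} log τ(x, S_r) / (−log r) = d(f), where τ(x, S_r) = min{n ∈ ℕ⁺ : Tⁿ(x) ∈ S_r}. -/

import Mathlib

open Filter MeasureTheory Metric Set Topology ENNReal NNReal

/-- Hitting time of the set `S` for the orbit of `x` under `T`: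
`τ(x,S) = min {n ∈ ℕ⁺ : Tⁿ x ∈ S}`, equal to `⊤` if the orbit never enters `S`. -/
noncomputable def hitTime {X : Type*} (T : X → X) (S : Set X) (x : X) : ℕ∞ :=
  sInf ((fun n : ℕ => (n : ℕ∞)) '' {n : ℕ | 0 < n ∧ T^[n] x ∈ S})

/-- Superpolynomial decay of correlations with respect to Lipschitz observables: there is
`Φ : ℕ → [0,∞)` with `n^α Φ(n) → 0` for every `α > 0` such that
`|∫ φ∘Tⁿ ψ dμ − ∫φ dμ ∫ψ dμ| ≤ ‖φ‖ ‖ψ‖ Φ(n)` for all Lipschitz `φ, ψ : X → ℝ`, where `‖φ‖`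
is the Lipschitz norm (the supremum norm plus the Lipschitz constant). -/
def SuperpolynomialDecayOfCorrelations {X : Type*} [MetricSpace X] [MeasurableSpace X]
    (μ : MeasureTheory.Measure X) (T : X → X) : Prop :=
  ∃ Φ : ℕ → ℝ, (∀ n, 0 ≤ Φ n) ∧
    (∀ α : ℝ, 0 < α → Tendsto (fun n : ℕ => (n : ℝ) ^ α * Φ n) atTop (𝓝 0)) ∧
    ∀ (φ ψ : X → ℝ) (Kφ Kψ : ℝ≥0) (Cφ Cψ : ℝ),
      LipschitzWith Kφ φ → LipschitzWith Kψ ψ →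
      (∀ x, |φ x| ≤ Cφ) → (∀ x, |ψ x| ≤ Cψ) → ∀ n : ℕ,
      |(∫ x, φ (T^[n] x) * ψ x ∂μ) - (∫ x, φ x ∂μ) * ∫ x, ψ x ∂μ|
        ≤ (Cφ + Kφ) * (Cψ + Kψ) * Φ n

theorem hitTime_le {X : Type*} {T : X → X} {S : Set X} {x : X} {n : ℕ} (hn : 0 < n)
    (h : T^[n] x ∈ S) : hitTime T S x ≤ n :=
  sInf_le ⟨n, ⟨hn, h⟩, rfl⟩

theorem hitTime_eq_top_or_exists {X : Type*} (T : X → X) (S : Set X) (x : X) :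
    hitTime T S x = ⊤ ∨ ∃ n : ℕ, 0 < n ∧ T^[n] x ∈ S ∧ hitTime T S x = n := by
  unfold hitTime
  rcases (((fun n : ℕ => (n : ℕ∞)) '' {n : ℕ | 0 < n ∧ T^[n] x ∈ S})).eq_empty_or_nonempty
    with h | h
  · left; rw [h]; exact sInf_empty
  · right
    obtain ⟨n, ⟨h0, hn⟩, he⟩ := csInf_mem h
    exact ⟨n, h0, hn, he.symm⟩

theorem Real.eventually_rpow_le_rpow_of_comparable (s : ℝ) {ε : ℝ} (hε : 0 < ε) :
    ∀ᶠ r : ℝ in 𝓝[>] 0, ∀ ρ : ℝ, r / 2 ≤ ρ → ρ ≤ 2 * r →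
      r ^ (s + ε) ≤ ρ ^ s ∧ ρ ^ s ≤ r ^ (s - ε) := by
  have hlim : Tendsto (fun r : ℝ => ε * -Real.log r) (𝓝[>] 0) atTop :=
    (tendsto_neg_atBot_atTop.comp Real.tendsto_log_nhdsGT_zero).const_mul_atTop hε
  filter_upwards [hlim.eventually_ge_atTop (|s| * Real.log 2), self_mem_nhdsWithin]
    with r hr (hr0 : 0 < r) ρ h1 h2
  have hρ : 0 < ρ := by linarith
  have hdist : |Real.log ρ - Real.log r| ≤ Real.log 2 := by
    have a := Real.log_le_log (by positivity) h1
    have b := Real.log_le_log hρ h2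
    rw [Real.log_div hr0.ne' two_ne_zero] at a
    rw [Real.log_mul two_ne_zero hr0.ne'] at b
    rw [abs_le]; constructor <;> linarith
  have hs : |s * (Real.log ρ - Real.log r)| ≤ |s| * Real.log 2 := by
    rw [abs_mul]; gcongr
  obtain ⟨h3, h4⟩ := abs_le.1 hs
  simp only [Real.rpow_def_of_pos hr0, Real.rpow_def_of_pos hρ, Real.exp_le_exp]
  constructor <;> linarith

theorem eventually_rpow_le_measureReal_le_rpow {X : Type*} [MeasurableSpace X]
    (μ : Measure X) [IsProbabilityMeasure μ] {S : ℝ → Set X} {d : ℝ}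
    (hd : Tendsto (fun r : ℝ => ENNReal.log (μ (S r)) / ((Real.log r : ℝ) : EReal))
      (𝓝[>] 0) (𝓝 (d : EReal))) {ε : ℝ} (hε : 0 < ε) :
    ∀ᶠ r : ℝ in 𝓝[>] 0, r ^ (d + ε) ≤ μ.real (S r) ∧ μ.real (S r) ≤ r ^ (d - ε) := by
  have hlt := hd.eventually (gt_mem_nhds (EReal.coe_lt_coe_iff.2 (lt_add_of_pos_right d hε)))
  have hgt := hd.eventually (lt_mem_nhds (EReal.coe_lt_coe_iff.2 (sub_lt_self d hε)))
  filter_upwards [hlt, hgt, Ioo_mem_nhdsGT (zero_lt_one' ℝ)] with r h1 h2 ⟨h0, hr1⟩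
  have hlog : Real.log r < 0 := Real.log_neg h0 hr1
  have hne : μ (S r) ≠ 0 := by
    intro h
    rw [h, ENNReal.log_zero, EReal.bot_div_of_neg_ne_bot (by exact_mod_cast hlog)
      (EReal.coe_ne_bot _)] at h1
    exact absurd h1 (by simp)
  have hpos : 0 < μ.real (S r) := ENNReal.toReal_pos hne (measure_ne_top _ _)
  rw [ENNReal.log_pos_real hne (measure_ne_top _ _), ← EReal.coe_div,
    EReal.coe_lt_coe_iff] at h1 h2
  change Real.log (μ.real (S r)) / _ < _ at h1
  change _ < Real.log (μ.real (S r)) / _ at h2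
  rw [div_lt_iff_of_neg hlog] at h1
  rw [lt_div_iff_of_neg hlog] at h2
  rw [Real.rpow_def_of_pos h0, Real.rpow_def_of_pos h0, ← Real.exp_log hpos, Real.exp_le_exp,
    Real.exp_le_exp]
  constructor <;> linarith

theorem ae_eventually_notMem_of_measureReal_le_rpow {X : Type*} [MeasurableSpace X]
    (μ : Measure X) [IsProbabilityMeasure μ] {E : ℝ → Set X} {C ε : ℝ} (hε : 0 < ε)
    (hE : ∀ᶠ r : ℝ in 𝓝[>] 0, μ.real (E r) ≤ C * r ^ ε) :
    ∀ᵐ x ∂μ, ∀ᶠ k : ℕ in atTop, x ∉ E ((1 / 2) ^ k) := by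
  have hlim : Tendsto (fun k : ℕ => (1 / 2 : ℝ) ^ k) atTop (𝓝[>] 0) :=
    tendsto_pow_atTop_nhdsWithin_zero_of_lt_one (by norm_num) (by norm_num)
  have hsum : Summable fun k : ℕ => C * ((1 / 2 : ℝ) ^ ε) ^ k :=
    (summable_geometric_of_lt_one (by positivity)
      (Real.rpow_lt_one (by norm_num) (by norm_num) hε)).mul_left C
  have hsum' : Summable fun k : ℕ => μ.real (E ((1 / 2) ^ k)) := by
    refine Summable.of_norm_bounded_eventually_nat hsum ?_
    filter_upwards [hlim.eventually hE] with k hk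
    rw [Real.norm_of_nonneg measureReal_nonneg, ← Real.rpow_mul_natCast (by norm_num), mul_comm ε,
      Real.rpow_natCast_mul (by norm_num)]
    exact hk
  refine ae_eventually_notMem ?_
  have := hsum'.tsum_ofReal_ne_top
  simpa [Measure.real] using this

theorem tendsto_log_div_neg_log_of_rpow_bounds {τ : ℝ → ℝ≥0∞} {d : ℝ}
    (h : ∀ ε : ℝ, 0 < ε → ∀ᶠ r : ℝ in 𝓝[>] 0,
      ENNReal.ofReal (r ^ (-(d - ε))) ≤ τ r ∧ τ r ≤ ENNReal.ofReal (r ^ (-(d + ε)))) :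
    Tendsto (fun r : ℝ => ENNReal.log (τ r) / ((-Real.log r : ℝ) : EReal))
      (𝓝[>] 0) (𝓝 (d : EReal)) := by
  have key : ∀ ε : ℝ, 0 < ε → ∀ᶠ r : ℝ in 𝓝[>] 0,
      ((d - ε : ℝ) : EReal) ≤ ENNReal.log (τ r) / ((-Real.log r : ℝ) : EReal) ∧
      ENNReal.log (τ r) / ((-Real.log r : ℝ) : EReal) ≤ ((d + ε : ℝ) : EReal) := by
    intro ε hε
    filter_upwards [h ε hε, Ioo_mem_nhdsGT (zero_lt_one' ℝ)] with r ⟨h1, h2⟩ ⟨h0, hr1⟩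
    have hlog : 0 < -Real.log r := neg_pos.2 (Real.log_neg h0 hr1)
    have hlog' : (0 : EReal) ≤ ((-Real.log r : ℝ) : EReal) := by exact_mod_cast hlog.le
    have hval : ∀ s : ℝ, ENNReal.log (ENNReal.ofReal (r ^ (-s))) / ((-Real.log r : ℝ) : EReal)
        = (s : EReal) := by
      intro s
      rw [ENNReal.log_ofReal_of_pos (Real.rpow_pos_of_pos h0 _), Real.log_rpow h0,
        ← EReal.coe_div, neg_mul_comm, mul_div_cancel_right₀ _ hlog.ne']
    rw [← hval (d - ε), ← hval (d + ε)]
    exact ⟨EReal.div_le_div_right_of_nonneg hlog' (ENNReal.log_le_log h1),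
      EReal.div_le_div_right_of_nonneg hlog' (ENNReal.log_le_log h2)⟩
  refine tendsto_order.2 ⟨fun a ha => ?_, fun a ha => ?_⟩
  · obtain ⟨q, hq1, hq2⟩ := EReal.lt_iff_exists_real_btwn.1 ha
    have hq : q < d := EReal.coe_lt_coe_iff.1 hq2
    filter_upwards [key (d - q) (sub_pos.2 hq)] with r hr
    rw [show d - (d - q) = q by ring] at hr
    exact hq1.trans_le hr.1
  · obtain ⟨q, hq1, hq2⟩ := EReal.lt_iff_exists_real_btwn.1 ha
    have hq : d < q := EReal.coe_lt_coe_iff.1 hq1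
    filter_upwards [key (q - d) (sub_pos.2 hq)] with r hr
    rw [show d + (q - d) = q by ring] at hr
    exact hr.2.trans_lt hq2

theorem card_filter_max_sub_min_lt_le (N L i : ℕ) :
    ((Finset.Icc 1 N).filter fun j => max i j - min i j < L).card ≤ 2 * L := by
  calc _ ≤ (Finset.Ico (i + 1 - L) (i + L)).card := by
        refine Finset.card_le_card fun j hj => ?_
        simp only [Finset.mem_filter, Finset.mem_Ico] at *
        omega
    _ ≤ 2 * L := by
        rw [Nat.card_Ico]; omega

/-- A second moment bound on the probability that a nonnegative observable vanishes along the
first `N` iterates, in terms of an eventual bound on its autocorrelations. -/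
theorem MeasureTheory.MeasurePreserving.measureReal_forall_iterate_eq_zero_le
    {X : Type*} [MeasurableSpace X] {μ : Measure X} [IsProbabilityMeasure μ] {T : X → X}
    (hT : MeasurePreserving T μ μ) {φ : X → ℝ} (hφ : Measurable φ) (h0 : ∀ x, 0 ≤ φ x)
    (h1 : ∀ x, φ x ≤ 1) {B : ℝ} (hB : 0 ≤ B) (L N : ℕ)
    (hcorr : ∀ n, L ≤ n → ∫ x, φ (T^[n] x) * φ x ∂μ - (∫ x, φ x ∂μ) * ∫ x, φ x ∂μ ≤ B) :
    (N * ∫ x, φ x ∂μ) ^ 2 * μ.real {x | ∀ n ∈ Finset.Icc 1 N, φ (T^[n] x) = 0}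
      ≤ 2 * L * (N * ∫ x, φ x ∂μ) + N ^ 2 * B := by
  set m := ∫ x, φ x ∂μ with hm
  have hTm : ∀ n, Measurable T^[n] := fun n => (hT.iterate n).measurable
  have bdd_int : ∀ (g : X → ℝ) (C : ℝ), Measurable g → (∀ x, |g x| ≤ C) → Integrable g μ :=
    fun g C hg hC => Integrable.of_bound hg.aestronglyMeasurable C (ae_of_all _ hC)
  have hφi : Integrable φ μ := bdd_int φ 1 hφ fun x => abs_le.2 ⟨by linarith [h0 x], h1 x⟩
  have inv : ∀ (n : ℕ) (g : X → ℝ), Measurable g → ∫ x, g (T^[n] x) ∂μ = ∫ x, g x ∂μ := by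
    intro n g hg
    conv_rhs => rw [← (hT.iterate n).map_eq]
    exact (integral_map (hTm n).aemeasurable hg.aestronglyMeasurable).symm
  have hm0 : 0 ≤ m := integral_nonneg h0
  have hm1 : m ≤ 1 := by
    calc m ≤ ∫ _, (1 : ℝ) ∂μ := integral_mono hφi (integrable_const 1) h1
      _ = 1 := by simp
  set g : X → ℝ := fun x => φ x - m with hg
  have hgm : Measurable g := hφ.sub_const m
  have hgb : ∀ x, |g x| ≤ 1 := fun x =>
    abs_le.2 ⟨by simp only [hg]; linarith [h0 x], by simp only [hg]; linarith [h1 x]⟩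
  have hprod_m : ∀ i j : ℕ, Measurable fun x => g (T^[i] x) * g (T^[j] x) := fun i j =>
    (hgm.comp (hTm i)).mul (hgm.comp (hTm j))
  have hprod : ∀ i j : ℕ, Integrable (fun x => g (T^[i] x) * g (T^[j] x)) μ := fun i j =>
    bdd_int _ 1 (hprod_m i j) fun x => by
      rw [abs_mul]; exact mul_le_one₀ (hgb _) (abs_nonneg _) (hgb _)
  have hφprod : ∀ n : ℕ, Integrable (fun x => φ (T^[n] x) * φ x) μ := fun n =>
    bdd_int _ 1 ((hφ.comp (hTm n)).mul hφ) fun x => by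
      rw [abs_of_nonneg (mul_nonneg (h0 _) (h0 _))]; exact mul_le_one₀ (h1 _) (h0 _) (h1 _)
  have hφT : ∀ n : ℕ, Integrable (fun x => φ (T^[n] x)) μ := fun n =>
    bdd_int _ 1 (hφ.comp (hTm n)) fun x => abs_le.2 ⟨by linarith [h0 (T^[n] x)], h1 _⟩
  have hcov : ∀ n : ℕ, ∫ x, g (T^[n] x) * g x ∂μ = ∫ x, φ (T^[n] x) * φ x ∂μ - m * m := by
    intro n
    have e : (fun x => g (T^[n] x) * g x)
        = fun x => φ (T^[n] x) * φ x - (m * φ (T^[n] x) + m * φ x) + m * m := by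
      funext x; simp only [hg]; ring
    have i2 : Integrable (fun x => m * φ (T^[n] x) + m * φ x) μ :=
      ((hφT n).const_mul m).add (hφi.const_mul m)
    have i3 : Integrable (fun x => φ (T^[n] x) * φ x - (m * φ (T^[n] x) + m * φ x)) μ :=
      (hφprod n).sub i2
    rw [e, integral_add i3 (integrable_const _), integral_sub (hφprod n) i2,
      integral_add ((hφT n).const_mul m) (hφi.const_mul m), integral_const_mul,
      integral_const_mul, inv n φ hφ, ← hm]
    simp only [integral_const, probReal_univ, one_smul]
    ring
  have hcov_le : ∀ n : ℕ, ∫ x, g (T^[n] x) * g x ∂μ ≤ (if n < L then m else 0) + B := by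
    intro n
    rw [hcov]
    split_ifs with hn
    · have : ∫ x, φ (T^[n] x) * φ x ∂μ ≤ m :=
        integral_mono (hφprod n) hφi fun x => mul_le_of_le_one_left (h0 _) (h1 _)
      nlinarith [mul_nonneg hm0 hm0]
    · rw [zero_add]; exact hcorr n (not_lt.1 hn)
  have hle_pair : ∀ i j : ℕ, i ≤ j →
      ∫ x, g (T^[j] x) * g (T^[i] x) ∂μ = ∫ x, g (T^[j - i] x) * g x ∂μ := by
    intro i j hij
    rw [← inv i (fun x => g (T^[j - i] x) * g x) ((hgm.comp (hTm _)).mul hgm)]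
    simp only [← Function.iterate_add_apply, Nat.sub_add_cancel hij]
  have hpair : ∀ i j : ℕ, ∫ x, g (T^[i] x) * g (T^[j] x) ∂μ
      = ∫ x, g (T^[max i j - min i j] x) * g x ∂μ := by
    intro i j
    rcases le_total i j with h | h
    · rw [max_eq_right h, min_eq_left h, ← hle_pair i j h]
      simp only [mul_comm]
    · rw [max_eq_left h, min_eq_right h, ← hle_pair j i h]
  have hexpand : ∀ x, (∑ i ∈ Finset.Icc 1 N, g (T^[i] x)) ^ 2
      = ∑ i ∈ Finset.Icc 1 N, ∑ j ∈ Finset.Icc 1 N, g (T^[i] x) * g (T^[j] x) := fun x => by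
    rw [sq, Finset.sum_mul_sum]
  have hint : Integrable (fun x => (∑ i ∈ Finset.Icc 1 N, g (T^[i] x)) ^ 2) μ := by
    simp only [hexpand]
    exact integrable_finsetSum _ fun i _ => integrable_finsetSum _ fun j _ => hprod i j
  have hvar : ∫ x, (∑ i ∈ Finset.Icc 1 N, g (T^[i] x)) ^ 2 ∂μ
      ≤ 2 * L * (N * m) + N ^ 2 * B := by
    simp only [hexpand]
    rw [integral_finsetSum _ fun i _ => integrable_finsetSum _ fun j _ => hprod i j]
    calc _ ≤ ∑ i ∈ Finset.Icc 1 N, (2 * L * m + N * B) := by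
          refine Finset.sum_le_sum fun i _ => ?_
          rw [integral_finsetSum _ fun j _ => hprod i j]
          calc _ ≤ ∑ j ∈ Finset.Icc 1 N, ((if max i j - min i j < L then m else 0) + B) :=
                Finset.sum_le_sum fun j _ => (hpair i j).trans_le (hcov_le _)
            _ = ((Finset.Icc 1 N).filter fun j => max i j - min i j < L).card * m + N * B := by
                rw [Finset.sum_add_distrib, ← Finset.sum_filter]
                simp
            _ ≤ 2 * L * m + N * B := by
                gcongr
                exact_mod_cast card_filter_max_sub_min_lt_le N L i
      _ = _ := by simp; ring
  refine le_trans ?_ hvar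
  refine le_trans (mul_le_mul_of_nonneg_left (measureReal_mono fun x hx => ?_) (sq_nonneg _))
    (mul_meas_ge_le_integral_of_nonneg (ae_of_all _ fun x => sq_nonneg _) hint ((N * m) ^ 2))
  have : ∑ i ∈ Finset.Icc 1 N, g (T^[i] x) = -(N * m) := by
    simp only [hg]
    rw [Finset.sum_sub_distrib, Finset.sum_eq_zero hx]
    simp
  simp [this]

theorem MeasureTheory.MeasurePreserving.measureReal_exists_iterate_mem_le
    {X : Type*} [MeasurableSpace X] {μ : Measure X} {T : X → X}
    (hT : MeasurePreserving T μ μ) {S : Set X} (hS : MeasurableSet S) (N : ℕ) :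
    μ.real {x | ∃ n ∈ Finset.Icc 1 N, T^[n] x ∈ S} ≤ N * μ.real S := by
  have : {x | ∃ n ∈ Finset.Icc 1 N, T^[n] x ∈ S} = ⋃ n ∈ Finset.Icc 1 N, T^[n] ⁻¹' S := by
    ext x; simp
  rw [this]
  refine (measureReal_biUnion_finset_le _ _).trans_eq ?_
  simp [(hT.iterate _).measureReal_preimage hS.nullMeasurableSet]

theorem nonneg_of_tendsto_log_measure_div_log {X : Type*} [MeasurableSpace X]
    (μ : Measure X) [IsProbabilityMeasure μ] {S : ℝ → Set X} {d : ℝ}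
    (hd : Tendsto (fun r : ℝ => ENNReal.log (μ (S r)) / ((Real.log r : ℝ) : EReal))
      (𝓝[>] 0) (𝓝 (d : EReal))) : 0 ≤ d := by
  by_contra! h
  obtain ⟨r, ⟨h1, -⟩, h0, hr⟩ :=
    ((eventually_rpow_le_measureReal_le_rpow μ hd (by linarith : 0 < -d / 2)).and
      (Ioo_mem_nhdsGT (zero_lt_one' ℝ))).exists
  have := Real.one_lt_rpow_of_pos_of_lt_one_of_neg h0 hr (by linarith : d + -d / 2 < 0)
  linarith [measureReal_le_one (μ := μ) (s := S r)]

/-- A Lipschitz approximation of the indicator function of the sublevel set `{f ≤ r}`. -/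
noncomputable def sublevelCutoff {X : Type*} (f : X → ℝ) (r : ℝ) (x : X) : ℝ :=
  max 0 (min 1 (2 - 2 / r * f x))

section sublevelCutoff

variable {X : Type*} (f : X → ℝ) {r : ℝ} (x : X)

theorem sublevelCutoff_nonneg : 0 ≤ sublevelCutoff f r x := le_max_left _ _

theorem sublevelCutoff_le_one : sublevelCutoff f r x ≤ 1 :=
  max_le zero_le_one (min_le_left _ _)

variable {f x}

theorem one_le_sublevelCutoff (hr : 0 < r) (h : f x ≤ r / 2) : 1 ≤ sublevelCutoff f r x := by
  refine le_max_of_le_right (le_min le_rfl ?_)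
  have : 2 / r * f x ≤ 2 / r * (r / 2) := by gcongr
  have e : 2 / r * (r / 2) = 1 := by field_simp
  linarith

theorem sublevelCutoff_eq_zero (hr : 0 < r) (h : ¬ f x ≤ r) : sublevelCutoff f r x = 0 := by
  refine max_eq_left (min_le_of_right_le ?_)
  have : 2 / r * r ≤ 2 / r * f x := by gcongr; exact (not_le.1 h).le
  have e : 2 / r * r = 2 := by field_simp
  linarith

theorem LipschitzWith.sublevelCutoff [MetricSpace X] {ℓ : ℝ≥0} (hf : LipschitzWith ℓ f)
    (hr : 0 < r) : LipschitzWith (2 / r.toNNReal * ℓ) (sublevelCutoff f r) := by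
  refine LipschitzWith.const_max (LipschitzWith.const_min ?_ 1) 0
  refine LipschitzWith.of_dist_le_mul fun x y => ?_
  have h := hf.dist_le_mul x y
  rw [Real.dist_eq] at h ⊢
  have e : 2 - 2 / r * f x - (2 - 2 / r * f y) = -(2 / r * (f x - f y)) := by ring
  rw [e, abs_neg, abs_mul, abs_of_pos (by positivity : 0 < 2 / r)]
  push_cast
  rw [Real.coe_toNNReal r hr.le, mul_assoc]
  gcongr

end sublevelCutoff

/-- Under superpolynomial decay of correlations, the orbit misses `{f ≤ r}` up to time
`r ^ (-(d + 3ε))` only with probability `O(r ^ ε)`. -/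
theorem SuperpolynomialDecayOfCorrelations.eventually_measureReal_forall_notMem_le
    {X : Type*} [MetricSpace X] [MeasurableSpace X] [BorelSpace X]
    {μ : Measure X} [IsProbabilityMeasure μ] {T : X → X} (hT : MeasurePreserving T μ μ)
    (hmix : SuperpolynomialDecayOfCorrelations μ T) {ℓ : ℝ≥0} {f : X → ℝ}
    (hf : LipschitzWith ℓ f) {d : ℝ}
    (hd : Tendsto (fun r : ℝ => ENNReal.log (μ {y | f y ≤ r}) / ((Real.log r : ℝ) : EReal))
      (𝓝[>] 0) (𝓝 (d : EReal))) {ε : ℝ} (hε : 0 < ε) :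
    ∀ᶠ r : ℝ in 𝓝[>] 0,
      μ.real {x | ∀ n ∈ Finset.Icc 1 ⌊r ^ (-(d + 3 * ε))⌋₊, ¬ f (T^[n] x) ≤ r}
        ≤ (8 + (1 + 2 * ℓ) ^ 2) * r ^ ε := by
  have hd0 : 0 ≤ d := nonneg_of_tendsto_log_measure_div_log μ hd
  obtain ⟨Φ, -, hΦ, hcor⟩ := hmix
  set α : ℝ := (2 + 2 * d + 3 * ε) / ε with hα
  have hα0 : 0 < α := by positivity
  have hεα : ε * α = 2 + 2 * d + 3 * ε := by rw [hα]; field_simp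
  obtain ⟨n₀, hn₀⟩ := eventually_atTop.1 ((hΦ α hα0).eventually (ge_mem_nhds zero_lt_one))
  have hhalf : Tendsto (fun r : ℝ => r / 2) (𝓝[>] 0) (𝓝[>] 0) := by
    refine tendsto_nhdsWithin_iff.2 ⟨?_, ?_⟩
    · exact ((continuous_id.div_const (2 : ℝ)).tendsto' 0 0 (by simp)).mono_left
        nhdsWithin_le_nhds
    · filter_upwards [self_mem_nhdsWithin] with r (hr : 0 < r)
      exact half_pos hr
  filter_upwards [hhalf.eventually (eventually_rpow_le_measureReal_le_rpow μ hd (half_pos hε)),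
    Real.eventually_rpow_le_rpow_of_comparable (d + ε / 2) (half_pos hε),
    (tendsto_rpow_neg_nhdsGT_zero (neg_lt_zero.2 hε)).eventually_ge_atTop (n₀ : ℝ),
    Ioo_mem_nhdsGT (zero_lt_one' ℝ)] with r hμ hcomp hrn ⟨hr0, hr1⟩
  set φ := sublevelCutoff f r
  have hlip : LipschitzWith (2 / r.toNNReal * ℓ) φ := hf.sublevelCutoff hr0
  have hφm : Measurable φ := hlip.continuous.measurable
  have hφ0 : ∀ x, 0 ≤ φ x := sublevelCutoff_nonneg f
  have hφ1 : ∀ x, φ x ≤ 1 := sublevelCutoff_le_one f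
  have hφb : ∀ x, |φ x| ≤ 1 := fun x => by rw [abs_of_nonneg (hφ0 x)]; exact hφ1 x
  set m := ∫ x, φ x ∂μ with hm
  set u := r ^ ε
  set M := r ^ (d + ε)
  set A := r ^ (-(d + 3 * ε))
  set v := r ^ (-ε)
  have hu : 0 < u := Real.rpow_pos_of_pos hr0 _
  have hM : 0 < M := Real.rpow_pos_of_pos hr0 _
  have hv : 1 ≤ v := Real.one_le_rpow_of_pos_of_le_one_of_nonpos hr0 hr1.le (by linarith)
  have hA : 1 ≤ A := Real.one_le_rpow_of_pos_of_le_one_of_nonpos hr0 hr1.le (by linarith)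
  have hvAM : v = u * (A * M) := by
    simp only [u, v, A, M, ← Real.rpow_add hr0]
    congr 1; ring
  have hMm : M ≤ m := by
    have hint : Integrable φ μ := Integrable.of_bound hφm.aestronglyMeasurable 1 (ae_of_all _ hφb)
    calc M = r ^ (d + ε / 2 + ε / 2) := by simp only [M]; congr 1; ring
      _ ≤ (r / 2) ^ (d + ε / 2) := (hcomp (r / 2) le_rfl (by linarith)).1
      _ ≤ μ.real {y | f y ≤ r / 2} := hμ.1
      _ ≤ μ.real {x | 1 ≤ φ x} := measureReal_mono fun x hx => one_le_sublevelCutoff hr0 hx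
      _ ≤ m := by
        simpa using mul_meas_ge_le_integral_of_nonneg (ae_of_all _ hφ0) hint 1
  have hm0 : 0 < m := hM.trans_le hMm
  set N := ⌊A⌋₊
  set L := ⌈v⌉₊
  have hN : A ≤ 2 * N := by
    have h1 : (1 : ℝ) ≤ N := by exact_mod_cast Nat.le_floor (by exact_mod_cast hA)
    linarith [Nat.lt_floor_add_one A]
  have hL : (L : ℝ) ≤ 2 * v := by linarith [Nat.ceil_lt_add_one (zero_le_one.trans hv)]
  have hcorr : ∀ n, L ≤ n → ∫ x, φ (T^[n] x) * φ x ∂μ - m * m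
      ≤ (1 + 2 * ℓ) ^ 2 * (M ^ 2 * u) := by
    intro n hn
    refine (le_of_abs_le (hcor φ φ _ _ 1 1 hlip hlip hφb hφb n)).trans ?_
    have hvn : v ≤ n := (Nat.le_ceil v).trans (by exact_mod_cast hn)
    have hn0 : (0 : ℝ) < n := by linarith
    have hΦn : Φ n ≤ r ^ (2 : ℝ) * (M ^ 2 * u) := by
      have h1 : (n : ℝ) ^ α * Φ n ≤ 1 := hn₀ n (by exact_mod_cast hrn.trans hvn)
      have h2 : v ^ α ≤ (n : ℝ) ^ α := by gcongr
      have h3 : v ^ α * (r ^ (2 : ℝ) * (M ^ 2 * u)) = 1 := by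
        simp only [u, v, M, ← Real.rpow_natCast, ← Real.rpow_mul hr0.le, ← Real.rpow_add hr0]
        rw [neg_mul, hεα, ← Real.rpow_zero r]
        congr 1; push_cast; ring
      have h4 : 0 < v ^ α := Real.rpow_pos_of_pos (by linarith) _
      have h5 : 0 < r ^ (2 : ℝ) * (M ^ 2 * u) := by positivity
      have h6 : (n : ℝ) ^ α * Φ n ≤ (n : ℝ) ^ α * (r ^ (2 : ℝ) * (M ^ 2 * u)) := by
        calc _ ≤ 1 := h1
          _ = v ^ α * (r ^ (2 : ℝ) * (M ^ 2 * u)) := h3.symm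
          _ ≤ _ := by gcongr
      exact le_of_mul_le_mul_left h6 (h4.trans_le h2)
    have hK : 1 + ((2 / r.toNNReal * ℓ : ℝ≥0) : ℝ) ≤ (1 + 2 * ℓ) / r := by
      push_cast
      rw [Real.coe_toNNReal r hr0.le, le_div_iff₀ hr0]
      have : (1 + 2 / r * ℓ) * r = r + 2 * ℓ := by field_simp
      linarith
    calc _ ≤ (1 + ((2 / r.toNNReal * ℓ : ℝ≥0) : ℝ)) * (1 + ((2 / r.toNNReal * ℓ : ℝ≥0) : ℝ))
          * (r ^ (2 : ℝ) * (M ^ 2 * u)) := by gcongr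
      _ ≤ ((1 + 2 * ℓ) / r) * ((1 + 2 * ℓ) / r) * (r ^ (2 : ℝ) * (M ^ 2 * u)) := by gcongr
      _ = _ := by rw [Real.rpow_two]; field_simp
  have hmain := hT.measureReal_forall_iterate_eq_zero_le hφm hφ0 hφ1
    (by positivity : 0 ≤ (1 + 2 * (ℓ : ℝ)) ^ 2 * (M ^ 2 * u)) L N hcorr
  rw [← hm] at hmain
  have hNm : 0 < (N : ℝ) * m := mul_pos (by linarith) hm0
  have hLle : 2 * (L : ℝ) ≤ 8 * u * (N * m) := by
    calc 2 * (L : ℝ) ≤ 4 * (u * (A * M)) := by rw [← hvAM]; linarith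
      _ ≤ 4 * (u * (2 * N * m)) := by gcongr
      _ = _ := by ring
  have hsub : {x | ∀ n ∈ Finset.Icc 1 N, ¬ f (T^[n] x) ≤ r}
      ⊆ {x | ∀ n ∈ Finset.Icc 1 N, φ (T^[n] x) = 0} :=
    fun x hx n hn => sublevelCutoff_eq_zero hr0 (hx n hn)
  refine (measureReal_mono hsub).trans ?_
  refine le_of_mul_le_mul_left (hmain.trans ?_) (pow_pos hNm 2)
  calc 2 * L * (N * m) + N ^ 2 * ((1 + 2 * ℓ) ^ 2 * (M ^ 2 * u))
      ≤ 8 * u * (N * m) * (N * m) + N ^ 2 * ((1 + 2 * ℓ) ^ 2 * (m ^ 2 * u)) := by gcongr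
    _ = _ := by ring

theorem eventually_measureReal_exists_mem_le {X : Type*} [MeasurableSpace X]
    {μ : Measure X} [IsProbabilityMeasure μ] {T : X → X} (hT : MeasurePreserving T μ μ)
    {f : X → ℝ} (hf : Measurable f) {d : ℝ}
    (hd : Tendsto (fun r : ℝ => ENNReal.log (μ {y | f y ≤ r}) / ((Real.log r : ℝ) : EReal))
      (𝓝[>] 0) (𝓝 (d : EReal))) {ε : ℝ} (hε : 0 < ε) :
    ∀ᶠ r : ℝ in 𝓝[>] 0,
      μ.real {x | ∃ n ∈ Finset.Icc 1 ⌊r ^ (-(d - 2 * ε))⌋₊, f (T^[n] x) ≤ r} ≤ 1 * r ^ ε := by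
  filter_upwards [eventually_rpow_le_measureReal_le_rpow μ hd hε, self_mem_nhdsWithin]
    with r hr (hr0 : 0 < r)
  calc _ ≤ ⌊r ^ (-(d - 2 * ε))⌋₊ * μ.real {y | f y ≤ r} :=
        hT.measureReal_exists_iterate_mem_le (measurableSet_le hf measurable_const) _
    _ ≤ r ^ (-(d - 2 * ε)) * r ^ (d - ε) := by
        gcongr
        · exact Nat.floor_le (Real.rpow_nonneg hr0.le _)
        · exact hr.2
    _ = 1 * r ^ ε := by
        rw [← Real.rpow_add hr0, one_mul]; congr 1; ring

theorem exists_dyadic_near {r : ℝ} {k₀ : ℕ} (h0 : 0 < r) (hr : r < (1 / 2) ^ k₀) :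
    ∃ n, k₀ ≤ n ∧ (1 / 2 : ℝ) ^ (n + 1) < r ∧ r ≤ (1 / 2) ^ n := by
  obtain ⟨n, h1, h2⟩ := exists_nat_pow_near_of_lt_one h0
    (hr.le.trans (pow_le_one₀ (by norm_num) (by norm_num))) (by norm_num : (0 : ℝ) < 1 / 2)
    (by norm_num)
  refine ⟨n, ?_, h1, h2⟩
  have := (pow_lt_pow_iff_right_of_lt_one₀ (by norm_num : (0 : ℝ) < 1 / 2) (by norm_num)).1
    (h1.trans hr)
  omega

theorem eventually_rpow_le_hitTime_le_rpow {X : Type*} {T : X → X} {f : X → ℝ} {x : X} {d ε : ℝ}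
    (hε : 0 < ε)
    (hlow : ∀ᶠ k : ℕ in atTop, ¬ ∃ n ∈ Finset.Icc 1 ⌊((1 / 2 : ℝ) ^ k) ^ (-(d - 2 * ε))⌋₊,
      f (T^[n] x) ≤ (1 / 2) ^ k)
    (hup : ∀ᶠ k : ℕ in atTop, ¬ ∀ n ∈ Finset.Icc 1 ⌊((1 / 2 : ℝ) ^ k) ^ (-(d + 3 * ε))⌋₊,
      ¬ f (T^[n] x) ≤ (1 / 2) ^ k) :
    ∀ᶠ r : ℝ in 𝓝[>] 0,
      ENNReal.ofReal (r ^ (-(d - 4 * ε))) ≤ (hitTime T {y | f y ≤ r} x : ℝ≥0∞) ∧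
      (hitTime T {y | f y ≤ r} x : ℝ≥0∞) ≤ ENNReal.ofReal (r ^ (-(d + 4 * ε))) := by
  obtain ⟨k₀, hk₀⟩ := eventually_atTop.1 (hlow.and hup)
  filter_upwards [Ioo_mem_nhdsGT (by positivity : (0 : ℝ) < (1 / 2) ^ k₀),
    Real.eventually_rpow_le_rpow_of_comparable (-(d - 2 * ε)) (by positivity : 0 < 2 * ε),
    Real.eventually_rpow_le_rpow_of_comparable (-(d + 3 * ε)) hε] with r ⟨h0, hr⟩ hc1 hc2
  obtain ⟨k, hk, h1, h2⟩ := exists_dyadic_near h0 hr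
  rw [pow_succ] at h1
  constructor
  · rcases hitTime_eq_top_or_exists T {y | f y ≤ r} x with h | ⟨n, hn0, hn, he⟩
    · simp [h]
    rw [he]
    have hcmp := (hc1 ((1 / 2) ^ k) (by linarith) (by linarith)).1
    have hlt : ((1 / 2 : ℝ) ^ k) ^ (-(d - 2 * ε)) < n := by
      by_contra! hle
      exact (hk₀ k hk).1 ⟨n, Finset.mem_Icc.2 ⟨hn0, Nat.le_floor hle⟩, le_trans hn h2⟩
    rw [ENat.toENNReal_coe, ← ENNReal.ofReal_natCast]
    refine ENNReal.ofReal_le_ofReal (le_trans (le_of_eq ?_) (hcmp.trans hlt.le))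
    congr 1; ring
  · have hnot := (hk₀ (k + 1) (by omega)).2
    push Not at hnot
    obtain ⟨n, hn, hfn⟩ := hnot
    rw [Finset.mem_Icc] at hn
    rw [pow_succ] at hn hfn
    have hcmp := (hc2 ((1 / 2) ^ k * (1 / 2)) (by linarith) (by linarith)).2
    have hτ : hitTime T {y | f y ≤ r} x ≤ n := hitTime_le hn.1 (hfn.trans h1.le)
    calc (hitTime T {y | f y ≤ r} x : ℝ≥0∞) ≤ ((n : ℕ∞) : ℝ≥0∞) := by exact_mod_cast hτ
      _ = ENNReal.ofReal n := by rw [ENat.toENNReal_coe, ENNReal.ofReal_natCast]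
      _ ≤ _ := ENNReal.ofReal_le_ofReal ?_
    calc (n : ℝ) ≤ ((1 / 2 : ℝ) ^ k * (1 / 2)) ^ (-(d + 3 * ε)) :=
          (Nat.le_floor_iff (by positivity)).1 hn.2
      _ ≤ _ := hcmp
      _ = _ := by congr 1; ring

/-- Main theorem (logarithm law for hitting times in regular sets): if the system has
superpolynomial decay of correlations with respect to Lipschitz observables, `f : X → [0,∞)`
is `ℓ`-Lipschitz with sublevel sets `S_r = {x : f x ≤ r}`, and
`d(f) = lim_{r→0} log μ(S_r)/log r` exists, then for `μ`-a.e. `x`,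
`lim_{r→0} log τ(x,S_r)/(-log r) = d(f)`. -/
theorem logarithm_law_for_sublevel_sets
    {X : Type*} [MetricSpace X] [MeasurableSpace X] [BorelSpace X]
    (μ : Measure X) [IsProbabilityMeasure μ]
    (T : X → X) (hT : MeasurePreserving T μ μ)
    (hmix : SuperpolynomialDecayOfCorrelations μ T)
    (ℓ : ℝ≥0) (f : X → ℝ) (hf : LipschitzWith ℓ f) (hf0 : ∀ x, 0 ≤ f x)
    (d : ℝ)
    (hd : Tendsto (fun r : ℝ => ENNReal.log (μ {y | f y ≤ r}) / ((Real.log r : ℝ) : EReal))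
      (𝓝[>] 0) (𝓝 (d : EReal))) :
    ∀ᵐ x ∂μ,
      Tendsto (fun r : ℝ =>
          ENNReal.log ((hitTime T {y | f y ≤ r} x : ℝ≥0∞)) / ((- Real.log r : ℝ) : EReal))
        (𝓝[>] 0) (𝓝 (d : EReal)) := by
  have hfm : Measurable f := hf.continuous.measurable
  have hae : ∀ j : ℕ, ∀ᵐ x ∂μ, ∀ᶠ r : ℝ in 𝓝[>] 0,
      ENNReal.ofReal (r ^ (-(d - 4 * (1 / ((j : ℝ) + 1)))))
        ≤ (hitTime T {y | f y ≤ r} x : ℝ≥0∞) ∧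
      (hitTime T {y | f y ≤ r} x : ℝ≥0∞)
        ≤ ENNReal.ofReal (r ^ (-(d + 4 * (1 / ((j : ℝ) + 1))))) := by
    intro j
    have hj : (0 : ℝ) < 1 / ((j : ℝ) + 1) := Nat.one_div_pos_of_nat
    filter_upwards [ae_eventually_notMem_of_measureReal_le_rpow μ hj
        (eventually_measureReal_exists_mem_le hT hfm hd hj),
      ae_eventually_notMem_of_measureReal_le_rpow μ hj
        (hmix.eventually_measureReal_forall_notMem_le hT hf hd hj)] with x h1 h2
    exact eventually_rpow_le_hitTime_le_rpow hj h1 h2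
  filter_upwards [ae_all_iff.2 hae] with x hx
  refine tendsto_log_div_neg_log_of_rpow_bounds fun ε hε => ?_
  obtain ⟨j, hj⟩ := exists_nat_one_div_lt (by positivity : 0 < ε / 4)
  filter_upwards [hx j, Ioo_mem_nhdsGT (zero_lt_one' ℝ)] with r ⟨h1, h2⟩ ⟨h0, hr1⟩
  exact ⟨le_trans (ENNReal.ofReal_le_ofReal
      (Real.rpow_le_rpow_of_exponent_ge h0 hr1.le (by linarith))) h1,
    h2.trans (ENNReal.ofReal_le_ofReal
      (Real.rpow_le_rpow_of_exponent_ge h0 hr1.le (by linarith)))⟩
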